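/- arXiv:1610.08244 — 2 statements merged into one kernel-verified Lean document; each statement's English description precedes it below -/
import Mathlib

section
/- For λ > 0 and ν > 0, let m(λ, ν) = E[Y] = ∑_{y=0}^∞ y · λ^y / ((y!)^ν ζ(λ, ν)) denote the CMP mean. Then for fixed λ the function ν ↦ m(λ, ν) is differentiable, and the mixed cumulant identity ∂ m(λ, ν)/∂ν = −Cov(Y, ln(Y!)) holds, where Cov(Y, ln(Y!)) = E[Y ln(Y!)] − E[Y] E[ln(Y!)] with all expectations under the CMP(λ, ν) distribution. -/
/-- The Conway–Maxwell Poisson normalizing constant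
`ζ(λ, ν) = ∑_{s=0}^∞ λ^s / (s!)^ν`. -/
noncomputable def cmpZeta (lam nu : ℝ) : ℝ :=
  ∑' s : ℕ, lam ^ s / (s.factorial : ℝ) ^ nu

/-- The CMP probability mass function `p(y) = λ^y / ((y!)^ν ζ(λ, ν))`. -/
noncomputable def cmpPmf (lam nu : ℝ) (y : ℕ) : ℝ :=
  lam ^ y / ((y.factorial : ℝ) ^ nu * cmpZeta lam nu)

theorem summable_pow_div_factorial_rpow {x nu : ℝ} (hx : 0 < x) (hnu : 0 < nu) :
    Summable fun n : ℕ => x ^ n / (n.factorial : ℝ) ^ nu := by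
  have hpos : ∀ n : ℕ, 0 < x ^ n / (n.factorial : ℝ) ^ nu := fun n => by
    have : (0 : ℝ) < n.factorial := by exact_mod_cast n.factorial_pos
    positivity
  refine summable_of_ratio_test_tendsto_lt_one (l := 0) one_pos
    (Filter.Eventually.of_forall fun n => (hpos n).ne') ?_
  have hlim : Filter.Tendsto (fun n : ℕ => x / ((n : ℝ) + 1) ^ nu) Filter.atTop (nhds 0) :=
    Filter.Tendsto.const_div_atTop ((tendsto_rpow_atTop hnu).comp
      (Filter.tendsto_atTop_add_const_right _ 1 tendsto_natCast_atTop_atTop)) x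
  refine hlim.congr fun n => ?_
  have hf : (0 : ℝ) < n.factorial := by exact_mod_cast n.factorial_pos
  have hn : (0 : ℝ) < (n : ℝ) + 1 := by positivity
  rw [Real.norm_of_nonneg (hpos _).le, Real.norm_of_nonneg (hpos _).le, Nat.factorial_succ]
  push_cast
  rw [Real.mul_rpow hn.le hf.le]
  have := Real.rpow_pos_of_pos hf nu
  have := Real.rpow_pos_of_pos hn nu
  rw [pow_succ]
  field_simp

theorem summable_natCast_pow_mul_pow_div_factorial_rpow {x nu : ℝ} (hx : 0 < x) (hnu : 0 < nu)
    (k : ℕ) : Summable fun n : ℕ => (n : ℝ) ^ k * (x ^ n / (n.factorial : ℝ) ^ nu) := by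
  refine Summable.of_nonneg_of_le (fun n => by positivity) (fun n => ?_)
    ((summable_pow_div_factorial_rpow (mul_pos (Real.exp_pos 1) hx) hnu).mul_left
      (k.factorial : ℝ))
  have h := Real.pow_div_factorial_le_exp (n : ℝ) n.cast_nonneg k
  rw [div_le_iff₀ (by exact_mod_cast k.factorial_pos)] at h
  calc (n : ℝ) ^ k * (x ^ n / (n.factorial : ℝ) ^ nu)
      ≤ Real.exp n * k.factorial * (x ^ n / (n.factorial : ℝ) ^ nu) := by gcongr
    _ = _ := by rw [mul_pow, ← Real.exp_nat_mul, mul_one]; ring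

theorem log_factorial_le_sq (n : ℕ) : Real.log (n.factorial : ℝ) ≤ (n : ℝ) ^ 2 := by
  rcases n.eq_zero_or_pos with rfl | hn
  · simp
  have hn' : (0 : ℝ) < n := by exact_mod_cast hn
  calc Real.log (n.factorial : ℝ) ≤ Real.log ((n : ℝ) ^ n) :=
        Real.log_le_log (by exact_mod_cast n.factorial_pos) (by exact_mod_cast n.factorial_le_pow)
    _ = n * Real.log n := Real.log_pow _ _
    _ ≤ n * n := by gcongr; exact Real.log_le_self hn'.le
    _ = (n : ℝ) ^ 2 := by ring

theorem hasDerivAt_tsum_pow_div_factorial_rpow {x nu : ℝ} (hx : 0 < x) (hnu : 0 < nu) (k : ℕ) :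
    HasDerivAt (fun v : ℝ => ∑' n : ℕ, (n : ℝ) ^ k * (x ^ n / (n.factorial : ℝ) ^ v))
      (∑' n : ℕ, -((n : ℝ) ^ k * Real.log (n.factorial : ℝ)
        * (x ^ n / (n.factorial : ℝ) ^ nu))) nu := by
  have hmem : nu ∈ Set.Ioi (nu / 2) := half_lt_self hnu
  refine hasDerivAt_tsum_of_isPreconnected
    (g := fun (n : ℕ) (v : ℝ) => (n : ℝ) ^ k * (x ^ n / (n.factorial : ℝ) ^ v))
    (g' := fun (n : ℕ) (v : ℝ) => -((n : ℝ) ^ k * Real.log (n.factorial : ℝ)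
      * (x ^ n / (n.factorial : ℝ) ^ v)))
    (summable_natCast_pow_mul_pow_div_factorial_rpow hx (half_pos hnu) (k + 2))
    isOpen_Ioi isPreconnected_Ioi (fun n v _ => ?_) (fun n v hv => ?_) hmem
    (summable_natCast_pow_mul_pow_div_factorial_rpow hx hnu k) hmem
  · have hf : (0 : ℝ) < n.factorial := by exact_mod_cast n.factorial_pos
    have h := ((hasDerivAt_neg v).const_rpow hf).const_mul ((n : ℝ) ^ k * x ^ n)
    simp only [Real.rpow_neg hf.le] at h
    simp only [div_eq_mul_inv, ← mul_assoc]
    refine h.congr_deriv ?_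
    ring
  · have hf : (1 : ℝ) ≤ n.factorial := by exact_mod_cast n.factorial_pos
    have hlog := Real.log_nonneg hf
    rw [norm_neg, Real.norm_of_nonneg (by positivity), pow_add]
    gcongr
    · exact log_factorial_le_sq n
    · exact (Set.mem_Ioi.mp hv).le

theorem cmpZeta_pos {lam nu : ℝ} (hlam : 0 < lam) (hnu : 0 < nu) : 0 < cmpZeta lam nu :=
  (summable_pow_div_factorial_rpow hlam hnu).tsum_pos (fun n => by positivity) 0 (by simp)

theorem tsum_mul_cmpPmf (lam nu : ℝ) (g : ℕ → ℝ) :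
    ∑' y : ℕ, g y * cmpPmf lam nu y
      = (∑' y : ℕ, g y * (lam ^ y / (y.factorial : ℝ) ^ nu)) / cmpZeta lam nu := by
  rw [← tsum_div_const]
  simp only [cmpPmf, div_mul_eq_div_div, mul_div_assoc]

/-- Let `m(λ, ν) = E[Y]` be the CMP mean.  For fixed `λ > 0` the map `ν ↦ m(λ, ν)` is
differentiable on `(0, ∞)` and the mixed cumulant identity
`∂m/∂ν = −Cov(Y, ln(Y!)) = −(E[Y ln(Y!)] − E[Y] E[ln(Y!)])` holds. -/
theorem cmp_mixed_cumulant (lam : ℝ) (hlam : 0 < lam) (m : ℝ → ℝ)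
    (hm : ∀ v : ℝ, m v = ∑' y : ℕ, (y : ℝ) * cmpPmf lam v y) :
    ∀ nu : ℝ, 0 < nu →
      HasDerivAt m
        (-((∑' y : ℕ, (y : ℝ) * Real.log (y.factorial : ℝ) * cmpPmf lam nu y)
          - (∑' y : ℕ, (y : ℝ) * cmpPmf lam nu y)
            * (∑' y : ℕ, Real.log (y.factorial : ℝ) * cmpPmf lam nu y))) nu := by
  intro nu hnu
  have hm' : m = fun v => (∑' n : ℕ, (n : ℝ) * (lam ^ n / (n.factorial : ℝ) ^ v))
      / cmpZeta lam v := by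
    funext v
    rw [hm, tsum_mul_cmpPmf]
  have h0 : HasDerivAt (cmpZeta lam)
      (-∑' n : ℕ, Real.log (n.factorial : ℝ) * (lam ^ n / (n.factorial : ℝ) ^ nu)) nu := by
    have h := hasDerivAt_tsum_pow_div_factorial_rpow hlam hnu 0
    simp only [pow_zero, one_mul, tsum_neg] at h
    exact h
  have h1 := hasDerivAt_tsum_pow_div_factorial_rpow hlam hnu 1
  simp only [pow_one, tsum_neg] at h1
  have hz := (cmpZeta_pos hlam hnu).ne'
  rw [hm']
  refine (h1.div h0 hz).congr_deriv ?_
  simp only [tsum_mul_cmpPmf]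
  field_simp
  ring
end

section
/- Fix ν > 0. As λ → ∞, the CMP normalizing constant satisfies the asymptotic equivalence ζ(λ, ν) ~ exp(ν λ^{1/ν}) / ( λ^{(ν−1)/(2ν)} (2π)^{(ν−1)/2} √ν ); that is, the ratio ζ(λ, ν) · λ^{(ν−1)/(2ν)} (2π)^{(ν−1)/2} √ν · exp(−ν λ^{1/ν}) tends to 1 as λ → ∞. -/
open Real

open Filter Topology MeasureTheory Set

/-- The logarithm of `√x * (exp (-x) * x ^ s / s!)`, the Poisson probability mass function scaled by
its standard deviation. -/
noncomputable def logScaledPoisson (x : ℝ) (s : ℕ) : ℝ :=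
  log x / 2 - x + s * log x - log (s.factorial : ℝ)

theorem logScaledPoisson_le {y : ℝ} (hy : 0 < y) (s : ℕ) : logScaledPoisson y s ≤ 1 / 2 := by
  have hst := Stirling.le_log_factorial_stirling (Nat.succ_ne_zero s)
  have hpos : (0 : ℝ) < s + 1 := by positivity
  have hpi : 0 ≤ log (2 * π) := log_nonneg (by nlinarith [pi_gt_three])
  have hfac : log ((s + 1).factorial : ℝ) = log (s + 1) + log (s.factorial : ℝ) := by
    rw [Nat.factorial_succ, Nat.cast_mul, log_mul (by positivity) (by positivity)]
    push_cast
    rfl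
  rw [Nat.succ_eq_add_one, hfac] at hst
  push_cast at hst
  have hlog : log y - log (s + 1) ≤ y / (s + 1) - 1 := by
    rw [← log_div hy.ne' hpos.ne']
    exact log_le_sub_one_of_pos (by positivity)
  have hmul := mul_le_mul_of_nonneg_left hlog (by positivity : (0 : ℝ) ≤ s + 1 / 2)
  have hdiv : (s + 1 / 2 : ℝ) * (y / (s + 1) - 1) = y - (s + 1) - (y / (s + 1)) / 2 + 1 / 2 := by
    field_simp
    ring
  have : 0 ≤ y / (s + 1) := by positivity
  unfold logScaledPoisson
  linarith

theorem logScaledPoisson_le_sub_mul {x θ : ℝ} (hx : 0 < x) (hθ : |θ| ≤ 1) (hxθ : x * θ ^ 2 ≤ 1)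
    (s : ℕ) : logScaledPoisson x s ≤ 2 - θ * (s - x) := by
  have h := logScaledPoisson_le (mul_pos hx (exp_pos θ)) s
  unfold logScaledPoisson at h ⊢
  rw [log_mul hx.ne' (exp_ne_zero θ), log_exp] at h
  have hexp := (abs_le.1 (abs_exp_sub_one_sub_id_le hθ)).2
  have := mul_le_mul_of_nonneg_left hexp hx.le
  have := (abs_le.1 hθ).1
  nlinarith

theorem logScaledPoisson_le_sub_abs {x : ℝ} (hx : 1 ≤ x) (s : ℕ) :
    logScaledPoisson x s ≤ 2 - |(s - x) / √x| := by
  have hx0 : 0 < x := by linarith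
  have hsq : 1 ≤ √x := one_le_sqrt.2 hx
  have hinv : |(√x)⁻¹| ≤ 1 := by
    rw [abs_of_nonneg (by positivity)]
    exact inv_le_one_of_one_le₀ hsq
  have hxinv : x * (√x)⁻¹ ^ 2 ≤ 1 := by
    rw [inv_pow, sq_sqrt hx0.le, mul_inv_cancel₀ hx0.ne']
  have h₁ := logScaledPoisson_le_sub_mul hx0 hinv hxinv s
  have h₂ := logScaledPoisson_le_sub_mul (θ := -(√x)⁻¹) hx0 (by rwa [abs_neg])
    (by rwa [neg_sq]) s
  rw [div_eq_inv_mul]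
  rcases abs_cases ((√x)⁻¹ * (s - x)) with ⟨h, _⟩ | ⟨h, _⟩ <;> rw [h] <;> linarith

theorem tendsto_log_factorial_sub :
    Tendsto (fun n : ℕ => log (n.factorial : ℝ) - (n * log n - n + log n / 2)) atTop
      (𝓝 (log (2 * π) / 2)) := by
  have h := (Stirling.tendsto_stirlingSeq_sqrt_pi.log (by positivity)).add_const (log 2 / 2)
  have hlim : log √π + log 2 / 2 = log (2 * π) / 2 := by
    rw [log_sqrt pi_pos.le, log_mul two_ne_zero pi_ne_zero]
    ring
  rw [hlim] at h
  refine h.congr' ?_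
  filter_upwards [eventually_gt_atTop 0] with n hn
  have hn' : (0 : ℝ) < n := by exact_mod_cast hn
  rw [Stirling.stirlingSeq, log_div (by positivity) (by positivity),
    log_mul (by positivity) (by positivity), log_sqrt (by positivity), log_pow,
    log_div hn'.ne' (exp_ne_zero 1), log_exp, log_mul two_ne_zero hn'.ne']
  ring

theorem abs_one_add_mul_log_sub_le {w : ℝ} (hw : |w| ≤ 1 / 2) :
    |(1 + w) * log (1 + w) - w - w ^ 2 / 2| ≤ 4 * |w| ^ 3 := by
  have h := abs_log_sub_add_sum_range_le (x := -w) (by rw [abs_neg]; linarith) 2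
  simp only [Finset.sum_range_succ, Finset.sum_range_zero, abs_neg, sub_neg_eq_add] at h
  norm_num at h
  set R := -w + w ^ 2 / 2 + log (1 + w) with hR
  have hR' : |R| ≤ 2 * |w| ^ 3 := by
    refine h.trans ?_
    rw [div_le_iff₀ (by linarith)]
    nlinarith [pow_nonneg (abs_nonneg w) 3]
  have heq : (1 + w) * log (1 + w) - w - w ^ 2 / 2 = (1 + w) * R - w ^ 3 / 2 := by
    rw [hR]
    ring
  have hone_add : |1 + w| ≤ 3 / 2 := by
    have := abs_add_le 1 w
    rw [abs_one] at this
    linarith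
  calc |(1 + w) * log (1 + w) - w - w ^ 2 / 2| = |(1 + w) * R - w ^ 3 / 2| := by rw [heq]
    _ ≤ |(1 + w) * R| + |w ^ 3 / 2| := abs_sub _ _
    _ = |1 + w| * |R| + |w| ^ 3 / 2 := by
      rw [abs_mul, abs_div, abs_pow, abs_of_pos (two_pos : (0 : ℝ) < 2)]
    _ ≤ 3 / 2 * (2 * |w| ^ 3) + |w| ^ 3 / 2 := by gcongr
    _ ≤ 4 * |w| ^ 3 := by linarith [pow_nonneg (abs_nonneg w) 3]

theorem tendsto_logScaledPoisson {s : ℝ → ℕ} {t : ℝ}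
    (hs : Tendsto (fun x => (s x - x) / √x) atTop (𝓝 t)) :
    Tendsto (fun x => logScaledPoisson x (s x)) atTop (𝓝 (-(t ^ 2 / 2) - log (2 * π) / 2)) := by
  set δ : ℝ → ℝ := fun x => (s x - x) / √x with hδ
  set w : ℝ → ℝ := fun x => δ x * (√x)⁻¹ with hw
  have hw0 : Tendsto w atTop (𝓝 0) := by
    simpa using hs.mul (tendsto_inv_atTop_zero.comp tendsto_sqrt_atTop)
  have hsw : ∀ᶠ x in atTop, (s x : ℝ) = x * (1 + w x) := by
    filter_upwards [eventually_gt_atTop 0] with x hx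
    have : √x * √x = x := mul_self_sqrt hx.le
    have h0 : √x ≠ 0 := by positivity
    simp only [hw, hδ]
    field_simp
    rw [sq_sqrt hx.le]
    field_simp
    ring
  have hs_top : Tendsto s atTop atTop := by
    rw [← tendsto_natCast_atTop_iff (R := ℝ)]
    refine Tendsto.congr' (EventuallyEq.symm hsw) ?_
    exact tendsto_id.atTop_mul_pos one_pos (by simpa using hw0.const_add 1)
  have hmain : Tendsto (fun x => x * ((1 + w x) * log (1 + w x) - w x)) atTop
      (𝓝 (t ^ 2 / 2)) := by
    have hsmall : Tendsto (fun x => x * ((1 + w x) * log (1 + w x) - w x - w x ^ 2 / 2)) atTop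
        (𝓝 0) := by
      have hbd : Tendsto (fun x => 4 * (δ x ^ 2 * |w x|)) atTop (𝓝 0) := by
        simpa using ((hs.pow 2).mul hw0.abs).const_mul 4
      refine squeeze_zero_norm' ?_ hbd
      have hev : ∀ᶠ x in atTop, |w x| ≤ 1 / 2 :=
        (by simpa using hw0.abs : Tendsto (fun x => |w x|) atTop (𝓝 0)).eventually_le_const
          (by norm_num)
      filter_upwards [hev, eventually_gt_atTop 0] with x hwx hx
      have hxw : x * |w x| ^ 2 = δ x ^ 2 := by
        rw [sq_abs, hw]
        simp only [mul_pow, inv_pow, sq_sqrt hx.le]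
        field_simp
      rw [norm_eq_abs, abs_mul, abs_of_pos hx]
      calc x * _ ≤ x * (4 * |w x| ^ 3) := by gcongr; exact abs_one_add_mul_log_sub_le hwx
        _ = 4 * (x * |w x| ^ 2 * |w x|) := by ring
        _ = _ := by rw [hxw]
    have hsum := hsmall.add ((hs.pow 2).div_const 2)
    rw [zero_add] at hsum
    refine hsum.congr' ?_
    filter_upwards [eventually_gt_atTop 0] with x hx
    have hxw : x * w x ^ 2 = δ x ^ 2 := by
      simp only [hw, mul_pow, inv_pow, sq_sqrt hx.le]
      field_simp
    rw [← hxw]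
    ring
  have hlog : Tendsto (fun x => log (1 + w x) / 2) atTop (𝓝 0) := by
    simpa using ((hw0.const_add 1).log (by norm_num)).div_const 2
  have hall := (hmain.neg.sub hlog).sub (tendsto_log_factorial_sub.comp hs_top)
  rw [sub_zero] at hall
  refine hall.congr' ?_
  filter_upwards [hsw, hs_top.eventually_gt_atTop 0, eventually_gt_atTop 0] with x hx hs0 hx0
  have hs0' : (0 : ℝ) < s x := by exact_mod_cast hs0
  have hone_add : 0 < 1 + w x := by
    rw [hx] at hs0'
    exact pos_of_mul_pos_right hs0' hx0.le
  have hlogs : log (s x) = log x + log (1 + w x) := by rw [hx, log_mul hx0.ne' hone_add.ne']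
  simp only [Function.comp, logScaledPoisson]
  rw [hlogs]
  linear_combination (log (1 + w x) - 1) * hx

theorem integrable_exp_neg_mul_abs {c : ℝ} (hc : 0 < c) :
    Integrable (fun t : ℝ => exp (-c * |t|)) := by
  rw [← integrableOn_univ, ← Iic_union_Ioi (a := (0 : ℝ))]
  refine IntegrableOn.union ?_ ?_
  · refine (integrableOn_exp_mul_Iic hc 0).congr_fun (fun t ht => ?_) measurableSet_Iic
    simp only [abs_of_nonpos (mem_Iic.1 ht), mul_neg, neg_mul, neg_neg]
  · refine (exp_neg_integrableOn_Ioi 0 hc).congr_fun (fun t ht => ?_) measurableSet_Ioi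
    simp only [abs_of_pos (mem_Ioi.1 ht)]

/-- The integral of a step function with unit steps is the sum of its values. -/
theorem hasSum_of_integrableOn_floor {f : ℕ → ℝ}
    (hf : IntegrableOn (fun u : ℝ => f ⌊u⌋₊) (Ici 0)) :
    HasSum f (∫ u in Ici (0 : ℝ), f ⌊u⌋₊) := by
  have hunion : ⋃ n : ℕ, Ico (n : ℝ) (n + 1) = Ici 0 := by
    ext u
    simp only [mem_iUnion, mem_Ico, mem_Ici]
    exact ⟨fun ⟨n, hn, _⟩ => n.cast_nonneg.trans hn,
      fun hu => ⟨⌊u⌋₊, Nat.floor_le hu, Nat.lt_floor_add_one u⟩⟩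
  have hfloor : ∀ (n : ℕ), ∀ u ∈ Ico (n : ℝ) (n + 1), ⌊u⌋₊ = n := fun n u hu =>
    Nat.floor_eq_on_Ico n u hu
  have hdisj : Pairwise (Function.onFun Disjoint fun n : ℕ => Ico (n : ℝ) (n + 1)) := by
    intro m n hmn
    refine Set.disjoint_left.2 fun u hm hn => hmn ?_
    rw [← hfloor m u hm, hfloor n u hn]
  rw [← hunion] at hf ⊢
  have h := hasSum_integral_iUnion (fun n => measurableSet_Ico) hdisj hf
  have hval : ∀ n : ℕ, ∫ u in Ico (n : ℝ) (n + 1), f ⌊u⌋₊ = f n := fun n => by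
    rw [setIntegral_congr_fun measurableSet_Ico (g := fun _ => f n) fun u hu =>
      congrArg f (hfloor n u hu)]
    simp
  simpa only [hval] using h

/-- The powers of the scaled Poisson masses, as a step function of the standardized variable. -/
noncomputable def poissonStep (nu x t : ℝ) : ℝ :=
  (Ici (0 : ℝ)).indicator (fun u => exp (nu * logScaledPoisson x ⌊u⌋₊)) (x + √x * t)

theorem measurable_poissonStep (nu x : ℝ) : Measurable (poissonStep nu x) := by
  have h : Measurable fun u : ℝ => exp (nu * logScaledPoisson x ⌊u⌋₊) :=
    (measurable_from_nat (f := fun n => exp (nu * logScaledPoisson x n))).comp Nat.measurable_floor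
  exact (h.indicator measurableSet_Ici).comp (by fun_prop)

theorem norm_poissonStep_le {nu x : ℝ} (hnu : 0 < nu) (hx : 1 ≤ x) (t : ℝ) :
    ‖poissonStep nu x t‖ ≤ exp (3 * nu) * exp (-nu * |t|) := by
  have hsq : 1 ≤ √x := one_le_sqrt.2 hx
  rw [poissonStep, ← exp_add]
  by_cases hu : x + √x * t ∈ Ici (0 : ℝ)
  · rw [indicator_of_mem hu, norm_of_nonneg (exp_pos _).le, exp_le_exp]
    have h := logScaledPoisson_le_sub_abs hx ⌊x + √x * t⌋₊
    have hle := Nat.floor_le (mem_Ici.1 hu)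
    have hlt := Nat.lt_floor_add_one (x + √x * t)
    set n := ⌊x + √x * t⌋₊
    have hdist : |t - (n - x) / √x| ≤ 1 := by
      have heq : t - (n - x) / √x = (x + √x * t - n) / √x := by
        field_simp
        ring
      rw [heq, abs_of_nonneg (div_nonneg (by linarith) (by linarith)), div_le_one (by linarith)]
      linarith
    have habs := abs_sub_abs_le_abs_sub t ((n - x) / √x)
    nlinarith
  · rw [indicator_of_notMem hu, norm_zero]
    positivity

theorem tendsto_poissonStep (nu t : ℝ) :
    Tendsto (fun x => poissonStep nu x t) atTop
      (𝓝 (exp (nu * (-(t ^ 2 / 2) - log (2 * π) / 2)))) := by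
  have hpos : ∀ᶠ x in atTop, 0 ≤ x + √x * t := by
    filter_upwards [tendsto_sqrt_atTop.eventually_ge_atTop (-t), eventually_ge_atTop 0] with x ht hx
    nlinarith [mul_self_sqrt hx, sqrt_nonneg x]
  have hs : Tendsto (fun x => ((⌊x + √x * t⌋₊ : ℝ) - x) / √x) atTop (𝓝 t) := by
    have hlow : Tendsto (fun x => t - (√x)⁻¹) atTop (𝓝 t) := by
      simpa using (tendsto_inv_atTop_zero.comp tendsto_sqrt_atTop).const_sub t
    refine tendsto_of_tendsto_of_tendsto_of_le_of_le' hlow tendsto_const_nhds ?_ ?_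
    · filter_upwards [eventually_gt_atTop 0] with x hx
      have hsx := sqrt_pos.2 hx
      rw [le_div_iff₀ hsx, sub_mul, inv_mul_cancel₀ hsx.ne']
      linarith [Nat.lt_floor_add_one (x + √x * t)]
    · filter_upwards [hpos, eventually_gt_atTop 0] with x hxt hx
      rw [div_le_iff₀ (sqrt_pos.2 hx)]
      linarith [Nat.floor_le hxt]
  refine Tendsto.congr' ?_
    ((continuous_exp.tendsto _).comp ((tendsto_logScaledPoisson hs).const_mul nu))
  filter_upwards [hpos] with x hx
  simp only [Function.comp, poissonStep, indicator_of_mem (mem_Ici.2 hx)]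

theorem integrable_poissonStep {nu x : ℝ} (hnu : 0 < nu) (hx : 1 ≤ x) :
    Integrable (poissonStep nu x) :=
  ((integrable_exp_neg_mul_abs hnu).const_mul _).mono'
    (measurable_poissonStep nu x).aestronglyMeasurable
    (ae_of_all _ (norm_poissonStep_le hnu hx))

theorem tendsto_integral_poissonStep {nu : ℝ} (hnu : 0 < nu) :
    Tendsto (fun x => ∫ t, poissonStep nu x t) atTop
      (𝓝 (∫ t : ℝ, exp (nu * (-(t ^ 2 / 2) - log (2 * π) / 2)))) := by
  refine tendsto_integral_filter_of_dominated_convergence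
    (fun t => exp (3 * nu) * exp (-nu * |t|))
    (Eventually.of_forall fun x => (measurable_poissonStep nu x).aestronglyMeasurable) ?_
    ((integrable_exp_neg_mul_abs hnu).const_mul _) (ae_of_all _ (tendsto_poissonStep nu))
  filter_upwards [eventually_ge_atTop 1] with x hx
  exact ae_of_all _ (norm_poissonStep_le hnu hx)

theorem tsum_exp_mul_logScaledPoisson {nu x : ℝ} (hnu : 0 < nu) (hx : 1 ≤ x) :
    ∑' s : ℕ, exp (nu * logScaledPoisson x s) = √x * ∫ t, poissonStep nu x t := by
  have hsx : 0 < √x := sqrt_pos.2 (by linarith)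
  set g : ℝ → ℝ := (Ici (0 : ℝ)).indicator fun u => exp (nu * logScaledPoisson x ⌊u⌋₊)
  have hint : Integrable g := by
    have h : Integrable fun t => g (x + √x * t) := integrable_poissonStep hnu hx
    rw [integrable_comp_mul_left_iff (fun u => g (x + u)) hsx.ne'] at h
    simpa using h.comp_add_left (-x)
  have hsum := hasSum_of_integrableOn_floor (f := fun s => exp (nu * logScaledPoisson x s))
    ((integrable_indicator_iff measurableSet_Ici).1 hint)
  rw [hsum.tsum_eq, ← integral_indicator measurableSet_Ici]
  change ∫ u, g u = √x * ∫ t, g (x + √x * t)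
  rw [Measure.integral_comp_mul_left (fun u => g (x + u)), integral_add_left_eq_self g x,
    abs_of_pos (inv_pos.2 hsx), smul_eq_mul, mul_inv_cancel_left₀ hsx.ne']

theorem integral_exp_mul_gaussian_log {nu : ℝ} (hnu : 0 < nu) :
    (∫ t : ℝ, exp (nu * (-(t ^ 2 / 2) - log (2 * π) / 2))) * (2 * π) ^ ((nu - 1) / 2) * √nu
      = 1 := by
  have hpi : 0 < 2 * π := by positivity
  have heq : ∀ t : ℝ, exp (nu * (-(t ^ 2 / 2) - log (2 * π) / 2))
      = exp (-(nu / 2) * t ^ 2) * (2 * π) ^ (-(nu / 2)) := by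
    intro t
    rw [rpow_def_of_pos hpi, ← exp_add]
    ring_nf
  simp_rw [heq]
  rw [integral_mul_const, integral_gaussian]
  have hsqrt : √(π / (nu / 2)) * √nu = (2 * π) ^ (1 / 2 : ℝ) := by
    rw [← sqrt_mul (by positivity), ← sqrt_eq_rpow]
    congr 1
    field_simp
  calc √(π / (nu / 2)) * (2 * π) ^ (-(nu / 2)) * (2 * π) ^ ((nu - 1) / 2) * √nu
      = (√(π / (nu / 2)) * √nu) * ((2 * π) ^ (-(nu / 2)) * (2 * π) ^ ((nu - 1) / 2)) := by ring
    _ = 1 := by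
      rw [hsqrt, ← rpow_add hpi, ← rpow_add hpi]
      ring_nf
      exact rpow_zero _

theorem cmpZeta_mul_exp_eq {nu x : ℝ} (hnu : 0 < nu) (hx : 1 ≤ x) :
    cmpZeta (x ^ nu) nu * x ^ ((nu - 1) / 2) * exp (-(nu * x)) = ∫ t, poissonStep nu x t := by
  have hx0 : 0 < x := by linarith
  have hterm : ∀ s : ℕ, (x ^ nu) ^ s / (s.factorial : ℝ) ^ nu
      = exp (nu * logScaledPoisson x s) * exp (nu * x - nu / 2 * log x) := by
    intro s
    rw [← exp_log (by positivity : 0 < (x ^ nu) ^ s / (s.factorial : ℝ) ^ nu),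
      log_div (by positivity) (by positivity), log_pow, log_rpow hx0, log_rpow (by positivity),
      ← exp_add, logScaledPoisson]
    ring_nf
  rw [cmpZeta]
  simp_rw [hterm]
  rw [tsum_mul_right, tsum_exp_mul_logScaledPoisson hnu hx, sqrt_eq_rpow, rpow_def_of_pos hx0,
    rpow_def_of_pos hx0]
  set I := ∫ t, poissonStep nu x t
  have hone : exp (log x * (1 / 2)) * exp (nu * x - nu / 2 * log x)
      * exp (log x * ((nu - 1) / 2)) * exp (-(nu * x)) = 1 := by
    rw [← exp_add, ← exp_add, ← exp_add, exp_eq_one_iff]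
    ring
  linear_combination I * hone

/-- Fix `ν > 0`.  As `λ → ∞`,
`ζ(λ, ν) ~ exp(ν λ^{1/ν}) / (λ^{(ν−1)/(2ν)} (2π)^{(ν−1)/2} √ν)`: the ratio
`ζ(λ, ν) · λ^{(ν−1)/(2ν)} (2π)^{(ν−1)/2} √ν · exp(−ν λ^{1/ν})` tends to `1`. -/
theorem cmp_zeta_asymptotic (nu : ℝ) (hnu : 0 < nu) :
    Filter.Tendsto
      (fun lam : ℝ =>
        cmpZeta lam nu * lam ^ ((nu - 1) / (2 * nu)) * (2 * π) ^ ((nu - 1) / 2)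
          * Real.sqrt nu * Real.exp (-(nu * lam ^ (1 / nu))))
      Filter.atTop (nhds 1) := by
  have hlim :=
    ((tendsto_integral_poissonStep hnu).mul_const ((2 * π) ^ ((nu - 1) / 2))).mul_const √nu
  rw [integral_exp_mul_gaussian_log hnu] at hlim
  have hroot : Tendsto (fun lam : ℝ => lam ^ (1 / nu)) atTop atTop :=
    tendsto_rpow_atTop (by positivity)
  refine (hlim.comp hroot).congr' ?_
  filter_upwards [hroot.eventually_ge_atTop 1, eventually_ge_atTop 0] with lam hx hlam
  have hpow : (lam ^ (1 / nu)) ^ nu = lam := by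
    rw [← rpow_mul hlam, one_div_mul_cancel hnu.ne', rpow_one]
  have hexp : (lam ^ (1 / nu)) ^ ((nu - 1) / 2) = lam ^ ((nu - 1) / (2 * nu)) := by
    rw [← rpow_mul hlam]
    congr 1
    field_simp
  simp only [Function.comp]
  rw [← cmpZeta_mul_exp_eq hnu hx, hpow, hexp]
  ring
end
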